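/- Let Z = (ℂ^n,‖·‖) be a complex Banach space whose canonical basis is 1-unconditional, let H be an infinite-dimensional complex Hilbert space (X = B(H)), λ > 1, 1 ≤ p < ∞ and 1 ≤ q ≤ ∞. Define Ψ̃₁(n,λ,p,q) := E₅·λ^{−1}(λ^p−1)^{1/p}·n^{−1/q} if p > min{Cot(X),q}, and Ψ̃₁(n,λ,p,q) := E₆·λ^{−1}(λ^p−1)^{1/p}·n^{1/min{t,q} − 1/p − 1/q} if p ≤ min{Cot(X),q} and X has finite cotype t (E₅,E₆ the constants of the ℓ^n_q-estimates, independent of X and n); and define Ψ̃₂(n,λ,p,q) := 2^{1−1/p} λ n^{−1/p} if q ≤ Cot(X) and Ψ̃₂(n,λ,p,q) := 2^{1−1/p} λ n^{1/Cot(X) − 1/p − 1/q} if q > Cot(X). Then Ψ̃₁(n,λ,p,q)/‖Id : ℓ^n_q → Z‖ ≤ AP_λ(B_Z,p,X) ≤ ‖Id : Z → ℓ^n_q‖ · Ψ̃₂(n,λ,p,q). -/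

import Mathlib

open scoped BigOperators ENNReal NNReal Pointwise
open Finset

noncomputable section

namespace ArithBohr

/-- The monomial `z ^ α` on `ℂ^n`. -/
def mono {n : ℕ} (z : Fin n → ℂ) (α : Fin n → ℕ) : ℂ := ∏ i, z i ^ α i

/-- The real monomial `r ^ α`. -/
def monoR {n : ℕ} (r : Fin n → ℝ) (α : Fin n → ℕ) : ℝ := ∏ i, r i ^ α i

/-- `‖f‖_Ω = sup_{z ∈ Ω} ‖f z‖`. -/
def supNorm {n : ℕ} {E : Type*} [Norm E] (Ω : Set (Fin n → ℂ)) (f : (Fin n → ℂ) → E) : ℝ :=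
  ⨆ z : Ω, ‖f z.1‖

/-- `f` is bounded on `Ω`. -/
def IsBoundedOn {n : ℕ} {E : Type*} [Norm E] (Ω : Set (Fin n → ℂ)) (f : (Fin n → ℂ) → E) :
    Prop :=
  ∃ M : ℝ, ∀ z ∈ Ω, ‖f z‖ ≤ M

/-- A complete Reinhardt set in `ℂ^n`. -/
def IsCompleteReinhardt {n : ℕ} (Ω : Set (Fin n → ℂ)) : Prop :=
  ∀ z ∈ Ω, ∀ ξ : Fin n → ℂ, (∀ i, ‖ξ i‖ ≤ 1) → (fun i => ξ i * z i) ∈ Ω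

/-- The `ℓ_q` norm on `ℂ^n`, `q ∈ [1,∞]` (as an extended real exponent). -/
def lqNorm {n : ℕ} (q : ℝ≥0∞) (z : Fin n → ℂ) : ℝ :=
  if q = ∞ then ⨆ i, ‖z i‖ else (∑ i, ‖z i‖ ^ q.toReal) ^ (1 / q.toReal)

/-- The `ℓ_q` norm on `ℂ^n` for a real exponent `1 ≤ q < ∞`. -/
def lqNormR {n : ℕ} (q : ℝ) (z : Fin n → ℂ) : ℝ := (∑ i, ‖z i‖ ^ q) ^ (1 / q)

/-- The open unit ball of `ℓ^n_q`. -/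
def lqBall (n : ℕ) (q : ℝ≥0∞) : Set (Fin n → ℂ) := {z | lqNorm q z < 1}

/-- The open unit ball of `ℓ^n_q` for a real exponent. -/
def lqBallR (n : ℕ) (q : ℝ) : Set (Fin n → ℂ) := {z | lqNormR q z < 1}

/-- The open unit ball of `ℓ^n_1`. -/
def l1Ball (n : ℕ) : Set (Fin n → ℂ) := {z | ∑ i, ‖z i‖ < 1}

/-- `S(Ω₁, Ω₂) = inf {s > 0 : Ω₁ ⊆ s Ω₂}`. -/
def Sdist {n : ℕ} (Ω₁ Ω₂ : Set (Fin n → ℂ)) : ℝ := sInf {s : ℝ | 0 < s ∧ Ω₁ ⊆ s • Ω₂}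

/-- A norm on `ℂ^n` for which the canonical basis is `1`-unconditional. -/
structure UncondNorm (n : ℕ) where
  N : (Fin n → ℂ) → ℝ
  eq_zero_iff : ∀ z, N z = 0 ↔ z = 0
  add_le : ∀ z w, N (z + w) ≤ N z + N w
  smul_eq : ∀ (c : ℂ) (z), N (c • z) = ‖c‖ * N z
  uncond : ∀ ξ z : Fin n → ℂ, (∀ i, ‖ξ i‖ ≤ 1) → N (fun i => ξ i * z i) ≤ N z

namespace UncondNorm

variable {n : ℕ} (Z : UncondNorm n)

/-- The open unit ball `B_Z`. -/
def ball : Set (Fin n → ℂ) := {z | Z.N z < 1}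

/-- `‖Id : Z → ℓ^n_q‖ = sup_{z ∈ B_Z} ‖z‖_q`. -/
def toLq (q : ℝ≥0∞) : ℝ := ⨆ z : Z.ball, lqNorm q z.1

/-- `‖Id : ℓ^n_q → Z‖ = sup_{‖z‖_q ≤ 1} ‖z‖_Z`. -/
def fromLq (q : ℝ≥0∞) : ℝ := ⨆ z : {w : Fin n → ℂ | lqNorm q w ≤ 1}, Z.N z.1

/-- `‖Id : Z → ℓ^n_1‖ = sup_{z ∈ B_Z} Σ_i |z_i|`. -/
def toL1 : ℝ := ⨆ z : Z.ball, ∑ i, ‖z.1 i‖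

/-- `‖Id : ℓ^n_2 → Z‖`. -/
def fromL2 : ℝ := ⨆ z : {w : Fin n → ℂ | Real.sqrt (∑ i, ‖w i‖ ^ 2) ≤ 1}, Z.N z.1

/-- `sup_{z ∈ B_Z} ‖z‖_p` for a real exponent `p`. -/
def supLp (p : ℝ) : ℝ := ⨆ z : Z.ball, lqNormR p z.1

end UncondNorm

section Pluriharmonic

variable {n : ℕ} {H : Type*} [NormedAddCommGroup H] [InnerProductSpace ℂ H] [CompleteSpace H]
variable {Y : Type*} [NormedAddCommGroup Y] [NormedSpace ℂ Y]

/-- `f : Ω → B(H)` is (representable as) a pluriharmonic function with coefficient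
families `a`, `b`:  `f z = Σ_α a_α z^α + Σ_{|α| ≥ 1} b_α^* z̄^α` on `Ω`. -/
def Represents (Ω : Set (Fin n → ℂ)) (f : (Fin n → ℂ) → (H →L[ℂ] H))
    (a b : (Fin n → ℕ) → (H →L[ℂ] H)) : Prop :=
  b 0 = 0 ∧ ∀ z ∈ Ω,
    Summable (fun α => mono z α • a α) ∧
    Summable (fun α => mono (star z) α • (ContinuousLinearMap.adjoint (b α))) ∧
    f z = (∑' α, mono z α • a α) +
      ∑' α, mono (star z) α • (ContinuousLinearMap.adjoint (b α))

/-- The class `PH(Ω, B(H))` of bounded pluriharmonic functions (with their coefficients). -/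
def ClsPH (Ω : Set (Fin n → ℂ)) (f : (Fin n → ℂ) → (H →L[ℂ] H))
    (a b : (Fin n → ℕ) → (H →L[ℂ] H)) : Prop :=
  Represents Ω f a b ∧ IsBoundedOn Ω f

/-- The class `PH(^mΩ, B(H))` of `m`-homogeneous pluriharmonic polynomials. -/
def ClsHomog (Ω : Set (Fin n → ℂ)) (m : ℕ) (f : (Fin n → ℂ) → (H →L[ℂ] H))
    (a b : (Fin n → ℕ) → (H →L[ℂ] H)) : Prop :=
  ClsPH Ω f a b ∧ ∀ α : Fin n → ℕ, (∑ i, α i) ≠ m → a α = 0 ∧ b α = 0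

/-- The class `∪_{m ≥ 1} PH(^mΩ, B(H))`. -/
def ClsHomogUnion (Ω : Set (Fin n → ℂ)) (f : (Fin n → ℂ) → (H →L[ℂ] H))
    (a b : (Fin n → ℕ) → (H →L[ℂ] H)) : Prop :=
  ∃ m : ℕ, 1 ≤ m ∧ ClsHomog Ω m f a b

/-- The class `PH*(Ω, B(H))` of bounded pluriharmonic `f` with `f(0) = μ I`,
`μ ∈ [0, ‖f‖_Ω]`. -/
def ClsPHStar (Ω : Set (Fin n → ℂ)) (f : (Fin n → ℂ) → (H →L[ℂ] H))
    (a b : (Fin n → ℕ) → (H →L[ℂ] H)) : Prop :=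
  ClsPH Ω f a b ∧ ∃ μ : ℝ, 0 ≤ μ ∧ μ ≤ supNorm Ω f ∧ f 0 = (μ : ℂ) • (1 : H →L[ℂ] H)

/-- The vector `r ∈ ℝ^n_{≥0}` witnesses the arithmetic Bohr inequality for the class `Cls`:
`Σ_α (‖U a_α‖^p + ‖U b_α‖^p) r^{pα} ≤ λ^p ‖f‖_Ω^p` for every `f` in the class. -/
def GoodVec (Ω : Set (Fin n → ℂ)) (p lam : ℝ) (U : (H →L[ℂ] H) →L[ℂ] Y)
    (Cls : ((Fin n → ℂ) → (H →L[ℂ] H)) → ((Fin n → ℕ) → (H →L[ℂ] H)) →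
      ((Fin n → ℕ) → (H →L[ℂ] H)) → Prop) (r : Fin n → ℝ) : Prop :=
  ∀ f a b, Cls f a b → ∀ F : Finset (Fin n → ℕ),
    ∑ α ∈ F, (‖U (a α)‖ ^ p + ‖U (b α)‖ ^ p) * monoR r α ^ p ≤ lam ^ p * supNorm Ω f ^ p

/-- The `λ_p`-arithmetic Bohr radius of `Ω` with respect to a class of pluriharmonic
functions. -/
def APgen (Ω : Set (Fin n → ℂ)) (p lam : ℝ) (U : (H →L[ℂ] H) →L[ℂ] Y)
    (Cls : ((Fin n → ℂ) → (H →L[ℂ] H)) → ((Fin n → ℕ) → (H →L[ℂ] H)) →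
      ((Fin n → ℕ) → (H →L[ℂ] H)) → Prop) : ℝ :=
  sSup {t : ℝ | ∃ r : Fin n → ℝ, (∀ i, 0 ≤ r i) ∧ GoodVec Ω p lam U Cls r ∧
    t = (∑ i, r i) / n}

/-- The `λ_p`-arithmetic Bohr radius `AP_λ(Ω, p, U)`. -/
def APradius (Ω : Set (Fin n → ℂ)) (p lam : ℝ) (U : (H →L[ℂ] H) →L[ℂ] Y) : ℝ :=
  APgen Ω p lam U (ClsPH Ω)

/-- The `λ`-powered Bohr radius `R_λ(Ω, p, U)`. -/
def BohrRadius (Ω : Set (Fin n → ℂ)) (p lam : ℝ) (U : (H →L[ℂ] H) →L[ℂ] Y) : ℝ :=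
  sSup {r : ℝ | 0 ≤ r ∧ ∀ f a b, ClsPH Ω f a b → ∀ z ∈ Ω, ∀ F : Finset (Fin n → ℕ),
    ∑ α ∈ F, (‖U (a α)‖ ^ p + ‖U (b α)‖ ^ p) * ‖mono (r • z) α‖ ^ p
      ≤ lam ^ p * supNorm Ω f ^ p}

/-- `sup_{|z| < 1} ‖f z‖`. -/
def supNormDisk {E : Type*} [Norm E] (f : ℂ → E) : ℝ := ⨆ z : {w : ℂ // ‖w‖ < 1}, ‖f z.1‖

/-- `f` is bounded on the unit disk. -/
def IsBoundedOnDisk {E : Type*} [Norm E] (f : ℂ → E) : Prop :=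
  ∃ M : ℝ, ∀ z : ℂ, ‖z‖ < 1 → ‖f z‖ ≤ M

/-- `f : 𝔻 → B(H)` is pluriharmonic with coefficients `a`, `b`:
`f z = Σ_m a_m z^m + Σ_{m ≥ 1} b_m^* z̄^m`. -/
def RepresentsDisk (f : ℂ → (H →L[ℂ] H)) (a b : ℕ → (H →L[ℂ] H)) : Prop :=
  b 0 = 0 ∧ ∀ z : ℂ, ‖z‖ < 1 →
    Summable (fun m => z ^ m • a m) ∧
    Summable (fun m => (starRingEnd ℂ z) ^ m • (ContinuousLinearMap.adjoint (b m))) ∧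
    f z = (∑' m, z ^ m • a m) +
      ∑' m, (starRingEnd ℂ z) ^ m • (ContinuousLinearMap.adjoint (b m))

/-- The one-dimensional `λ`-powered Bohr radius `R_λ(𝔻, p, U)`. -/
def BohrRadiusDisk (p lam : ℝ) (U : (H →L[ℂ] H) →L[ℂ] Y) : ℝ :=
  sSup {r : ℝ | 0 ≤ r ∧ ∀ f a b, RepresentsDisk f a b → IsBoundedOnDisk f →
    ∀ F : Finset ℕ, ∑ m ∈ F, (‖U (a m)‖ ^ p + ‖U (b m)‖ ^ p) * r ^ ((m : ℝ) * p)
      ≤ lam ^ p * supNormDisk f ^ p}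

end Pluriharmonic

section Scalar

variable {n : ℕ}

/-- A complex-valued harmonic function on the unit disk, via its representation
`f z = Σ_m a_m z^m + conj (Σ_{m ≥ 1} b_m z^m)`. -/
def RepresentsDiskC (f : ℂ → ℂ) (a b : ℕ → ℂ) : Prop :=
  b 0 = 0 ∧ ∀ z : ℂ, ‖z‖ < 1 →
    Summable (fun m => a m * z ^ m) ∧ Summable (fun m => b m * z ^ m) ∧
    f z = (∑' m, a m * z ^ m) + starRingEnd ℂ (∑' m, b m * z ^ m)

/-- The scalar one-dimensional Bohr radius `R_λ(𝔻, 1, ℂ)` for harmonic functions. -/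
def BohrRadiusDiskC (lam : ℝ) : ℝ :=
  sSup {r : ℝ | 0 ≤ r ∧ ∀ f a b, RepresentsDiskC f a b → IsBoundedOnDisk f →
    ∀ F : Finset ℕ, ∑ m ∈ F, (‖a m‖ + ‖b m‖) * r ^ m ≤ lam * supNormDisk f}

/-- A complex-valued pluriharmonic function on `Ω ⊆ ℂ^n`, via its representation
`f z = Σ_α a_α z^α + conj (Σ_{|α| ≥ 1} b_α z^α)`. -/
def RepresentsC (Ω : Set (Fin n → ℂ)) (f : (Fin n → ℂ) → ℂ) (a b : (Fin n → ℕ) → ℂ) :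
    Prop :=
  b 0 = 0 ∧ ∀ z ∈ Ω,
    Summable (fun α => a α * mono z α) ∧ Summable (fun α => b α * mono z α) ∧
    f z = (∑' α, a α * mono z α) + starRingEnd ℂ (∑' α, b α * mono z α)

/-- The scalar arithmetic Bohr radius `AP_λ(Ω, 1, ℂ)` for pluriharmonic functions. -/
def APradiusC (Ω : Set (Fin n → ℂ)) (lam : ℝ) : ℝ :=
  sSup {t : ℝ | ∃ r : Fin n → ℝ, (∀ i, 0 ≤ r i) ∧
    (∀ f a b, RepresentsC Ω f a b → IsBoundedOn Ω f →
      ∀ F : Finset (Fin n → ℕ), ∑ α ∈ F, (‖a α‖ + ‖b α‖) * monoR r α ≤ lam * supNorm Ω f) ∧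
    t = (∑ i, r i) / n}

end Scalar

section Holomorphic

variable {n : ℕ} {X : Type*} [NormedAddCommGroup X] [NormedSpace ℂ X]
variable {Y : Type*} [NormedAddCommGroup Y] [NormedSpace ℂ Y]

/-- `f : Ω → X` has the monomial expansion `f z = Σ_α a_α z^α` on `Ω`. -/
def RepresentsHol (Ω : Set (Fin n → ℂ)) (f : (Fin n → ℂ) → X)
    (a : (Fin n → ℕ) → X) : Prop :=
  ∀ z ∈ Ω, HasSum (fun α => mono z α • a α) (f z)

/-- The `λ`-powered Bohr radius `K_λ(Ω, p, U)` for holomorphic functions. -/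
def Kradius (Ω : Set (Fin n → ℂ)) (p lam : ℝ) (U : X →L[ℂ] Y) : ℝ :=
  sSup {r : ℝ | 0 ≤ r ∧ ∀ f a, RepresentsHol Ω f a → IsBoundedOn Ω f →
    ∀ z ∈ Ω, ∀ F : Finset (Fin n → ℕ),
      ∑ α ∈ F, ‖mono (r • z) α • U (a α)‖ ^ p ≤ lam ^ p * supNorm Ω f ^ p}

/-- The `λ_p`-arithmetic Bohr radius `A_λ(Ω, p, U)` for holomorphic functions. -/
def Aradius (Ω : Set (Fin n → ℂ)) (p lam : ℝ) (U : X →L[ℂ] Y) : ℝ :=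
  sSup {t : ℝ | ∃ r : Fin n → ℝ, (∀ i, 0 ≤ r i) ∧
    (∀ f a, RepresentsHol Ω f a → IsBoundedOn Ω f →
      ∀ F : Finset (Fin n → ℕ),
        ∑ α ∈ F, ‖U (a α)‖ ^ p * monoR r α ^ p ≤ lam ^ p * supNorm Ω f ^ p) ∧
    t = (∑ i, r i) / n}

/-- `f : 𝔻 → X` has the power-series expansion `f z = Σ_m a_m z^m`. -/
def RepresentsHolDisk (f : ℂ → X) (a : ℕ → X) : Prop :=
  ∀ z : ℂ, ‖z‖ < 1 → HasSum (fun m => z ^ m • a m) (f z)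

/-- The one-dimensional `λ`-powered Bohr radius `K_λ(𝔻, p, U)`. -/
def KradiusDisk (p lam : ℝ) (U : X →L[ℂ] Y) : ℝ :=
  sSup {r : ℝ | 0 ≤ r ∧ ∀ f a, RepresentsHolDisk f a → IsBoundedOnDisk f →
    ∀ F : Finset ℕ, ∑ m ∈ F, ‖U (a m)‖ ^ p * r ^ ((m : ℝ) * p) ≤ lam ^ p * supNormDisk f ^ p}

end Holomorphic

/-- `X` has cotype `t ∈ [2, ∞)`. -/
def HasCotype (X : Type*) [NormedAddCommGroup X] (t : ℝ) : Prop :=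
  ∃ C : ℝ, 0 < C ∧ ∀ (m : ℕ) (x : Fin m → X),
    (∑ k, ‖x k‖ ^ t) ^ (1 / t) ≤
      C * Real.sqrt ((2 ^ m : ℝ)⁻¹ * ∑ ε : Fin m → Bool, ‖∑ k, (if ε k then x k else -x k)‖ ^ 2)

/-- `Cot(X) = inf {t ∈ [2, ∞] : X has cotype t}` (every space has cotype `∞`). -/
def cotype (X : Type*) [NormedAddCommGroup X] : ℝ≥0∞ :=
  sInf {t : ℝ≥0∞ | 2 ≤ t ∧ (t ≠ ∞ → HasCotype X t.toReal)}

/-- `X` has cotype `t ∈ [2, ∞]` (extended-real exponent; cotype `∞` always holds). -/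
def HasCotypeE (X : Type*) [NormedAddCommGroup X] (t : ℝ≥0∞) : Prop :=
  t = ∞ ∨ HasCotype X t.toReal

/-- The constant `D` of Theorem 1.1 / Theorem `thm-1.8-atm`. -/
def Dconst (p lam u : ℝ) : ℝ :=
  if (4 * lam * (2 : ℝ) ^ (1 / p))⁻¹ ≤ u then
    max ((4 * lam * (2 : ℝ) ^ (1 / p))⁻¹ * ((lam ^ p - u ^ p) / (2 * lam ^ p - u ^ p)) ^ (1 / p))
      ((4 * lam * (2 : ℝ) ^ (1 / p))⁻¹ *
        ((lam ^ p - u ^ p) / (lam ^ p - u ^ p + 1)) ^ (1 / p) * u⁻¹)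
  else
    max ((4 * lam * (2 : ℝ) ^ (1 / p))⁻¹ * ((lam ^ p - u ^ p) / (2 * lam ^ p - u ^ p)) ^ (1 / p))
      ((4 * lam * (2 : ℝ) ^ (1 / p))⁻¹ * ((lam ^ p - u ^ p) / (lam ^ p - u ^ p + 1)) ^ (1 / p))

end ArithBohr

namespace ArithBohr

universe u


open MeasureTheory in
lemma integral_fourier_prod {n : ℕ} (k : Fin n → ℤ) :
    ∫ θ : Fin n → UnitAddCircle, ∏ i, (fourier (k i) (θ i) : ℂ)
      ∂(Measure.pi (fun _ => AddCircle.haarAddCircle)) = if k = 0 then 1 else 0 := by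
  rw [integral_fintype_prod_eq_prod (fun i (x : UnitAddCircle) => (fourier (k i) x : ℂ))]
  have h1 : ∀ m : ℤ, ∫ x : UnitAddCircle, (fourier m x : ℂ) ∂AddCircle.haarAddCircle
      = if m = 0 then 1 else 0 := by
    intro m
    have := congrFun (fourierCoeff_fourier (T := 1) m) 0
    simp only [fourierCoeff, neg_zero, fourier_zero, one_smul] at this
    rw [this]
    simp [Pi.single_apply, eq_comm]
  simp only [h1]
  split_ifs with h
  · simp [h]
  · obtain ⟨i, hi⟩ := Function.ne_iff.1 h
    exact Finset.prod_eq_zero (Finset.mem_univ i) (by simpa using hi)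

lemma norm_fourier_prod {n : ℕ} (k : Fin n → ℤ) (θ : Fin n → UnitAddCircle) :
    ‖∏ i, (fourier (k i) (θ i) : ℂ)‖ = 1 := by
  rw [norm_prod]
  exact Finset.prod_eq_one fun i _ => Circle.norm_coe _

open MeasureTheory in
lemma coeff_bound {n : ℕ} {ι : Type*} [Countable ι] (k : ι → Fin n → ℤ) (c : ι → ℂ)
    (hc : Summable c) (M : ℝ)
    (hM : ∀ θ : Fin n → UnitAddCircle, ‖∑' j, c j * ∏ i, (fourier (k j i) (θ i) : ℂ)‖ ≤ M)
    (j₀ : ι) (h0 : ∀ j, j ≠ j₀ → k j = k j₀ → c j = 0) : ‖c j₀‖ ≤ M := by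
  classical
  set μ : Measure (Fin n → UnitAddCircle) := Measure.pi (fun _ => AddCircle.haarAddCircle) with hμ
  let F : ι → (Fin n → UnitAddCircle) → ℂ := fun j θ =>
    c j * ∏ i, (fourier ((k j - k j₀) i) (θ i) : ℂ)
  have hnF : ∀ j θ, ‖F j θ‖ = ‖c j‖ := fun j θ => by
    simp only [F, norm_mul, norm_fourier_prod, mul_one]
  have hFc : ∀ j, Continuous (F j) := fun j => by
    simp only [F]; fun_prop
  have hint : ∀ j, Integrable (F j) μ := fun j =>
    Integrable.of_bound (hFc j).aestronglyMeasurable (‖c j‖)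
      (Filter.Eventually.of_forall fun θ => (hnF j θ).le)
  have hs := hasSum_integral_of_summable_integral_norm hint (by
    simp only [hnF]; simpa using hc.norm)
  have hF : ∀ j, ∫ θ, F j θ ∂μ = if j = j₀ then c j₀ else 0 := by
    intro j
    simp only [F]
    rw [integral_const_mul, integral_fourier_prod]
    by_cases hj : j = j₀
    · simp [hj]
    · by_cases hk : k j = k j₀
      · simp [h0 j hj hk, hj]
      · simp [hj, sub_eq_zero, hk]
  simp only [hF] at hs
  have e := hs.unique (hasSum_ite_eq j₀ (c j₀))
  rw [← e]
  refine (norm_integral_le_of_norm_le_const (C := M)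
    (Filter.Eventually.of_forall fun θ => ?_)).trans (by simp)
  have : ∀ j, F j θ = (c j * ∏ i, (fourier (k j i) (θ i) : ℂ)) *
      ∏ i, (fourier (-(k j₀ i)) (θ i) : ℂ) := by
    intro j
    simp only [F, Pi.sub_apply, sub_eq_add_neg, fourier_add, Finset.prod_mul_distrib, mul_assoc]
  simp only [this]
  rw [tsum_mul_right, norm_mul]
  have h2 := norm_fourier_prod (fun i => -(k j₀ i)) θ
  rw [h2, mul_one]
  exact hM θ

lemma mono_torus {n : ℕ} (s : Fin n → ℝ) (θ : Fin n → UnitAddCircle) (α : Fin n → ℕ) :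
    mono (fun i => (s i : ℂ) * fourier 1 (θ i)) α
      = (monoR s α : ℂ) * ∏ i, (fourier ((α i : ℕ) : ℤ) (θ i) : ℂ) := by
  simp only [mono, monoR, mul_pow, Finset.prod_mul_distrib]
  push_cast
  congr 1
  refine Finset.prod_congr rfl fun i _ => ?_
  simp [fourier_apply, AddCircle.toCircle_nsmul]

lemma mono_torus_star {n : ℕ} (s : Fin n → ℝ) (θ : Fin n → UnitAddCircle) (α : Fin n → ℕ) :
    mono (star (fun i => (s i : ℂ) * fourier 1 (θ i))) α
      = (monoR s α : ℂ) * ∏ i, (fourier (-((α i : ℕ) : ℤ)) (θ i) : ℂ) := by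
  have : mono (star (fun i => (s i : ℂ) * fourier 1 (θ i))) α
      = starRingEnd ℂ (mono (fun i => (s i : ℂ) * fourier 1 (θ i)) α) := by
    simp [mono, map_prod]
  rw [this, mono_torus, map_mul, map_prod]
  simp only [fourier_neg, Complex.conj_ofReal]

lemma norm_fourier_one (x : UnitAddCircle) : ‖(fourier 1 x : ℂ)‖ = 1 := by
  exact Circle.norm_coe _

section
variable {n : ℕ} {H : Type*} [NormedAddCommGroup H] [InnerProductSpace ℂ H] [CompleteSpace H]

lemma opNorm_le_of_inner (T : H →L[ℂ] H) (M : ℝ) (hM : 0 ≤ M)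
    (h : ∀ x y : H, ‖inner ℂ y (T x)‖ ≤ M * ‖x‖ * ‖y‖) : ‖T‖ ≤ M := by
  refine T.opNorm_le_bound hM fun x => ?_
  have := h x (T x)
  rw [inner_self_eq_norm_sq_to_K, norm_pow, RCLike.norm_ofReal, abs_norm, sq] at this
  by_cases h0 : ‖T x‖ = 0
  · rw [h0]; positivity
  · have hp : 0 < ‖T x‖ := lt_of_le_of_ne (norm_nonneg _) (Ne.symm h0)
    exact le_of_mul_le_mul_right this hp

lemma cauchy_est (Ω : Set (Fin n → ℂ)) (f : (Fin n → ℂ) → (H →L[ℂ] H))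
    (a b : (Fin n → ℕ) → (H →L[ℂ] H)) (hf : Represents Ω f a b) (M : ℝ)
    (hM : ∀ z ∈ Ω, ‖f z‖ ≤ M) (s : Fin n → ℝ) (hs : ∀ i, 0 ≤ s i)
    (hsΩ : ∀ θ : Fin n → UnitAddCircle, (fun i => (s i : ℂ) * fourier 1 (θ i)) ∈ Ω)
    (α : Fin n → ℕ) : ‖a α‖ * monoR s α ≤ M ∧ ‖b α‖ * monoR s α ≤ M := by
  have hmon : ∀ β, 0 ≤ monoR s β := fun β => Finset.prod_nonneg fun i _ => pow_nonneg (hs i) _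
  have hM0 : 0 ≤ M := (norm_nonneg _).trans (hM _ (hsΩ 0))
  obtain ⟨hb0, hf⟩ := hf
  let k : (Fin n → ℕ) ⊕ (Fin n → ℕ) → Fin n → ℤ :=
    Sum.elim (fun α i => (α i : ℤ)) (fun α i => -(α i : ℤ))
  let B : (Fin n → ℕ) → (H →L[ℂ] H) := fun α => ContinuousLinearMap.adjoint (b α)
  have hB0 : B 0 = 0 := by simp [B, hb0]
  have key : ∀ x y : H, ∀ j, (j = Sum.inl α ∨ (j = Sum.inr α ∧ α ≠ 0)) →
      ‖(Sum.elim (fun β => (monoR s β : ℂ) * inner ℂ y (a β x))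
        (fun β => (monoR s β : ℂ) * inner ℂ y (B β x)) : _ → ℂ) j‖ ≤ M * ‖x‖ * ‖y‖ := by
    intro x y j hj
    let L : (H →L[ℂ] H) →L[ℂ] ℂ := (innerSL ℂ y).comp (ContinuousLinearMap.apply ℂ H x)
    have hL : ∀ T : H →L[ℂ] H, L T = inner ℂ y (T x) := fun T => rfl
    have hsum : ∀ θ : Fin n → UnitAddCircle,
        HasSum (fun j => (Sum.elim (fun β => (monoR s β : ℂ) * inner ℂ y (a β x))
          (fun β => (monoR s β : ℂ) * inner ℂ y (B β x)) : _ → ℂ) j *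
            ∏ i, (fourier (k j i) (θ i) : ℂ))
          (L (f (fun i => (s i : ℂ) * fourier 1 (θ i)))) := by
      intro θ
      obtain ⟨h1, h2, h3⟩ := hf _ (hsΩ θ)
      rw [h3, map_add]
      apply HasSum.sum
      · convert L.hasSum h1.hasSum using 2 with β
        simp only [Function.comp_apply, Sum.elim_inl, smul_apply,
          inner_smul_right, hL, mono_torus, k]
        ring
      · convert L.hasSum h2.hasSum using 2 with β
        simp only [Function.comp_apply, Sum.elim_inr, smul_apply,
          inner_smul_right, hL,
          mono_torus_star, k, B]
        ring
    refine coeff_bound k _ ?_ _ (fun θ => ?_) j ?_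
    · have := (hsum 0).summable
      simpa using this
    · rw [(hsum θ).tsum_eq, hL]
      calc _ ≤ ‖y‖ * ‖f (fun i => (s i : ℂ) * fourier 1 (θ i)) x‖ := norm_inner_le_norm _ _
        _ ≤ ‖y‖ * (M * ‖x‖) := by
          gcongr
          exact ((f _).le_opNorm x).trans (by gcongr; exact hM _ (hsΩ θ))
        _ = _ := by ring
    · have hz : ∀ β γ : Fin n → ℕ, (∀ i, (β i : ℤ) = -(γ i : ℤ)) → β = 0 ∧ γ = 0 := by
        intro β γ h
        constructor <;> (ext i; have := h i; simp only [Pi.zero_apply]; omega)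
      intro j' hne hk
      rcases hj with rfl | ⟨rfl, hα⟩
      · rcases j' with β | β
        · exfalso; apply hne; congr 1; ext i
          have := congrFun hk i
          simpa [k] using this
        · have := hz α β (fun i => (congrFun hk i).symm)
          simp [this.2, hB0]
      · rcases j' with β | β
        · have := hz β α (fun i => congrFun hk i)
          exact absurd this.2 hα
        · exfalso; apply hne; congr 1; ext i
          have := congrFun hk i
          simpa [k] using this
  have fin : ∀ T : H →L[ℂ] H, (∀ x y : H, ‖(monoR s α : ℂ) * inner ℂ y (T x)‖ ≤ M * ‖x‖ * ‖y‖) →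
      ‖T‖ * monoR s α ≤ M := by
    intro T hT
    have := opNorm_le_of_inner ((monoR s α : ℂ) • T) M hM0 (fun x y => by
      simpa [inner_smul_right] using hT x y)
    rw [norm_smul, Complex.norm_real, Real.norm_of_nonneg (hmon α), mul_comm] at this
    exact this
  refine ⟨fin _ fun x y => key x y (Sum.inl α) (Or.inl rfl), ?_⟩
  by_cases hα : α = 0
  · rw [hα, hb0]; simpa using hM0
  · have := fin (B α) fun x y => key x y (Sum.inr α) (Or.inr ⟨rfl, hα⟩)
    simpa [B] using this

lemma exists_orthonormal_fin (hH : ¬ FiniteDimensional ℂ H) (m : ℕ) :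
    ∃ v : Fin m → H, Orthonormal ℂ v := by
  have h : (m : Cardinal) ≤ Module.rank ℂ H := by
    have : Cardinal.aleph0 ≤ Module.rank ℂ H := by
      by_contra h
      exact hH (Module.rank_lt_aleph0_iff.1 (not_le.1 h))
    exact (Cardinal.natCast_le_aleph0).trans this
  obtain ⟨f, hf⟩ := exists_linearIndependent_of_le_rank h
  exact ⟨_, InnerProductSpace.gramSchmidtNormed_orthonormal hf⟩

lemma exists_diag (hH : ¬ FiniteDimensional ℂ H) (m : ℕ) :
    ∃ P : Fin m → (H →L[ℂ] H), (∀ i, ‖P i‖ = 1) ∧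
      ∀ (c : Fin m → ℂ) (K : ℝ), 0 ≤ K → (∀ i, ‖c i‖ ≤ K) → ‖∑ i, c i • P i‖ ≤ K := by
  obtain ⟨v, hv⟩ := exists_orthonormal_fin hH m
  refine ⟨fun i => (innerSL ℂ (v i)).smulRight (v i), fun i => ?_, fun c K hK hc => ?_⟩
  · simp [hv.1 i]
  · refine ContinuousLinearMap.opNorm_le_bound _ hK fun x => ?_
    have h1 : (∑ i, c i • (innerSL ℂ (v i)).smulRight (v i) : H →L[ℂ] H) x
        = ∑ i, (c i * inner ℂ (v i) x) • v i := by
      simp [smul_smul]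
    rw [h1]
    apply le_of_sq_le_sq _ (by positivity)
    have h2 : ‖∑ i, (c i * inner ℂ (v i) x) • v i‖ ^ 2 = ∑ i, ‖c i * inner ℂ (v i) x‖ ^ 2 := by
      rw [← inner_self_eq_norm_sq (𝕜 := ℂ), hv.inner_sum]
      simp only [map_sum]
      refine Finset.sum_congr rfl fun i _ => ?_
      rw [mul_comm, Complex.mul_conj, Complex.normSq_eq_norm_sq]
      exact Complex.ofReal_re _
    rw [h2, mul_pow]
    calc _ ≤ ∑ i, K ^ 2 * ‖inner ℂ (v i) x‖ ^ 2 := by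
          refine Finset.sum_le_sum fun i _ => ?_
          rw [norm_mul, mul_pow]
          gcongr
          exact hc i
      _ = K ^ 2 * ∑ i, ‖inner ℂ (v i) x‖ ^ 2 := by rw [Finset.mul_sum]
      _ ≤ _ := by
        gcongr
        exact hv.sum_inner_products_le x

lemma not_hasCotype (hH : ¬ FiniteDimensional ℂ H) (t : ℝ) (ht : 2 ≤ t) :
    ¬ HasCotype (H →L[ℂ] H) t := by
  rintro ⟨C, hC, h⟩
  obtain ⟨m, hm⟩ := exists_nat_gt (C ^ t)
  obtain ⟨P, hP, hPc⟩ := exists_diag hH m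
  have h1 := h m P
  have h2 : ∀ ε : Fin m → Bool, ‖∑ k, (if ε k then P k else -P k)‖ ≤ 1 := by
    intro ε
    have := hPc (fun k => if ε k then 1 else -1) 1 zero_le_one
      (fun i => by split_ifs <;> simp)
    convert this using 3 with k
    split_ifs <;> simp
  have h3 : (2 ^ m : ℝ)⁻¹ * ∑ ε : Fin m → Bool, ‖∑ k, (if ε k then P k else -P k)‖ ^ 2 ≤ 1 := by
    calc _ ≤ (2 ^ m : ℝ)⁻¹ * ∑ ε : Fin m → Bool, 1 := by
          gcongr with ε
          exact pow_le_one₀ (norm_nonneg _) (h2 ε)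
      _ = 1 := by simp
  simp only [hP, Real.one_rpow, Finset.sum_const, Finset.card_univ, Fintype.card_fin,
    nsmul_eq_mul, mul_one] at h1
  have h4 : (m : ℝ) ^ (1 / t) ≤ C := by
    refine h1.trans ?_
    calc _ ≤ C * 1 := by
          gcongr
          exact Real.sqrt_le_one.2 h3
      _ = C := mul_one C
  have h5 : (m : ℝ) ≤ C ^ t := by
    calc (m : ℝ) = ((m : ℝ) ^ (1 / t)) ^ t := by
          rw [← Real.rpow_mul (by positivity), one_div_mul_cancel (by linarith), Real.rpow_one]
      _ ≤ C ^ t := by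
          apply Real.rpow_le_rpow (by positivity) h4 (by linarith)
  linarith

lemma cotype_top (hH : ¬ FiniteDimensional ℂ H) : cotype (H →L[ℂ] H) = ∞ := by
  rw [cotype, sInf_eq_top]
  rintro t ⟨h2, h⟩
  by_contra ht
  refine not_hasCotype hH t.toReal ?_ (h ht)
  simpa using ENNReal.toReal_mono ht h2

end

section
variable {n : ℕ} (Z : UncondNorm n)

lemma N_zero : Z.N 0 = 0 := (Z.eq_zero_iff 0).2 rfl

lemma N_nonneg (z : Fin n → ℂ) : 0 ≤ Z.N z := by
  have := Z.uncond 0 z (fun i => by simp)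
  have h0 : (fun i => (0 : Fin n → ℂ) i * z i) = 0 := by ext i; simp
  rw [h0, N_zero] at this
  exact this

lemma N_single_pos (i : Fin n) : 0 < Z.N (Pi.single i 1) := by
  refine lt_of_le_of_ne (N_nonneg Z _) fun h => ?_
  have := congrFun ((Z.eq_zero_iff _).1 h.symm) i
  simp at this

lemma N_coord (z : Fin n → ℂ) (i : Fin n) : ‖z i‖ * Z.N (Pi.single i 1) ≤ Z.N z := by
  have := Z.uncond (Pi.single i 1) z (fun j => by
    by_cases h : j = i
    · subst h; simp
    · simp [h])
  have h0 : (fun j => (Pi.single i 1 : Fin n → ℂ) j * z j) = z i • Pi.single i 1 := by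
    ext j
    by_cases h : j = i
    · subst h; simp
    · simp [h]
  rw [h0, Z.smul_eq] at this
  exact this

lemma N_le_sum (z : Fin n → ℂ) : Z.N z ≤ ∑ i, ‖z i‖ * Z.N (Pi.single i 1) := by
  have h : ∀ (s : Finset (Fin n)), Z.N (∑ i ∈ s, z i • (Pi.single i 1 : Fin n → ℂ)) ≤
      ∑ i ∈ s, ‖z i‖ * Z.N (Pi.single i 1) := by
    intro s
    induction s using Finset.induction_on with
    | empty => simp [N_zero]
    | insert i s hi ih =>
      rw [Finset.sum_insert hi, Finset.sum_insert hi]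
      refine (Z.add_le _ _).trans ?_
      rw [Z.smul_eq]
      gcongr
  have := h Finset.univ
  have e : ∑ i, z i • (Pi.single i 1 : Fin n → ℂ) = z := by
    ext j
    simp [Finset.sum_apply, Pi.single_apply]
  rwa [e] at this

lemma toReal_one_le {q : ℝ≥0∞} (hq : 1 ≤ q) (hqt : q ≠ ∞) : 1 ≤ q.toReal := by
  simpa using ENNReal.toReal_mono hqt hq

lemma coord_le_lqNorm {q : ℝ≥0∞} (hq : 1 ≤ q) (z : Fin n → ℂ) (i : Fin n) :
    ‖z i‖ ≤ lqNorm q z := by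
  unfold lqNorm
  split_ifs with h
  · exact le_ciSup (f := fun i => ‖z i‖) (Set.finite_range _).bddAbove i
  · have h1 := toReal_one_le hq h
    calc ‖z i‖ = (‖z i‖ ^ q.toReal) ^ (1 / q.toReal) := by
          rw [← Real.rpow_mul (norm_nonneg _), mul_one_div_cancel (by linarith), Real.rpow_one]
      _ ≤ _ := by
        apply Real.rpow_le_rpow (by positivity) _ (by positivity)
        exact Finset.single_le_sum (f := fun i => ‖z i‖ ^ q.toReal)
          (fun i _ => by positivity) (Finset.mem_univ i)

lemma lqNorm_le_of_coord [NeZero n] {q : ℝ≥0∞} (R : ℝ) (z : Fin n → ℂ)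
    (h : ∀ i, ‖z i‖ ≤ R) : lqNorm q z ≤ max R ((∑ _i : Fin n, R ^ q.toReal) ^ (1 / q.toReal)) := by
  unfold lqNorm
  split_ifs with hq
  · exact (ciSup_le h).trans (le_max_left _ _)
  · refine le_trans ?_ (le_max_right _ _)
    apply Real.rpow_le_rpow (by positivity) _ (by positivity)
    exact Finset.sum_le_sum fun i _ => Real.rpow_le_rpow (norm_nonneg _) (h i) (by positivity)

lemma coord_le_toLq [NeZero n] {q : ℝ≥0∞} (hq : 1 ≤ q) (z : Fin n → ℂ) (hz : z ∈ Z.ball)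
    (i : Fin n) : ‖z i‖ ≤ Z.toLq q := by
  refine (coord_le_lqNorm hq z i).trans ?_
  let R : ℝ := ∑ i, (Z.N (Pi.single i 1))⁻¹
  refine le_ciSup (f := fun z : Z.ball => lqNorm q z.1)
    ⟨max R ((∑ _i : Fin n, R ^ q.toReal) ^ (1 / q.toReal)), ?_⟩ ⟨z, hz⟩
  rintro _ ⟨w, rfl⟩
  refine lqNorm_le_of_coord R _ fun i => ?_
  have h1 : ‖w.1 i‖ ≤ (Z.N (Pi.single i 1))⁻¹ := by
    rw [← one_div, le_div_iff₀ (N_single_pos Z i)]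
    exact (N_coord Z _ i).trans (le_of_lt w.2)
  exact h1.trans (Finset.single_le_sum (f := fun i => (Z.N (Pi.single i 1))⁻¹)
    (fun i _ => inv_nonneg.2 (N_nonneg Z _)) (Finset.mem_univ i))

lemma toLq_nonneg [NeZero n] {q : ℝ≥0∞} (hq : 1 ≤ q) : 0 ≤ Z.toLq q := by
  have := coord_le_toLq Z hq 0 (by simp [UncondNorm.ball, N_zero]) 0
  simpa using this

lemma N_le_fromLq {q : ℝ≥0∞} (hq : 1 ≤ q) (z : Fin n → ℂ) (hz : lqNorm q z ≤ 1) :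
    Z.N z ≤ Z.fromLq q := by
  refine le_ciSup (f := fun z : {w : Fin n → ℂ | lqNorm q w ≤ 1} => Z.N z.1)
    ⟨∑ i, Z.N (Pi.single i 1), ?_⟩ ⟨z, hz⟩
  rintro _ ⟨w, rfl⟩
  refine (N_le_sum Z _).trans (Finset.sum_le_sum fun i _ => ?_)
  exact mul_le_of_le_one_left (N_nonneg Z _) ((coord_le_lqNorm hq _ i).trans w.2)

lemma fromLq_pos [NeZero n] {q : ℝ≥0∞} (hq : 1 ≤ q) (hqt : q ≠ ∞) : 0 < Z.fromLq q := by
  have h1 := toReal_one_le hq hqt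
  refine (N_single_pos Z 0).trans_le (N_le_fromLq Z hq _ ?_)
  unfold lqNorm
  rw [if_neg hqt, Finset.sum_eq_single 0]
  · simp
  · intro j _ hj
    simp only [Pi.single_apply, if_neg hj, norm_zero]
    exact Real.zero_rpow (by linarith)
  · simp

end

section
variable {n : ℕ} {H : Type*} [NormedAddCommGroup H] [InnerProductSpace ℂ H] [CompleteSpace H]

lemma zero_mem_ball (Z : UncondNorm n) : (0 : Fin n → ℂ) ∈ Z.ball := by
  simp [UncondNorm.ball, N_zero]

lemma supNorm_ge (Ω : Set (Fin n → ℂ)) (f : (Fin n → ℂ) → (H →L[ℂ] H)) (hf : IsBoundedOn Ω f)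
    (z) (hz : z ∈ Ω) : ‖f z‖ ≤ supNorm Ω f := by
  obtain ⟨M, hM⟩ := hf
  exact le_ciSup (f := fun z : Ω => ‖f z.1‖)
    ⟨M, by rintro _ ⟨w, rfl⟩; exact hM w.1 w.2⟩ ⟨z, hz⟩

lemma mono_single (z : Fin n → ℂ) (i : Fin n) : mono z (Pi.single i 1) = z i := by
  unfold mono
  rw [Finset.prod_eq_single i]
  · simp
  · intro j _ hj; simp [hj]
  · simp

lemma monoR_single (z : Fin n → ℝ) (i : Fin n) : monoR z (Pi.single i 1) = z i := by
  unfold monoR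
  rw [Finset.prod_eq_single i]
  · simp
  · intro j _ hj; simp [hj]
  · simp

lemma single_one_inj (i j : Fin n) (h : (Pi.single i 1 : Fin n → ℕ) = Pi.single j 1) : i = j := by
  by_contra hne
  have := congrFun h i
  simp [hne] at this

lemma upper_vec (hH : ¬ FiniteDimensional ℂ H) [NeZero n] (p lam : ℝ) (hp : 1 ≤ p)
    (hlam : 1 < lam) {q : ℝ≥0∞} (hq : 1 ≤ q) (Z : UncondNorm n) (r : Fin n → ℝ)
    (hr : ∀ i, 0 ≤ r i)
    (hg : GoodVec Z.ball p lam (ContinuousLinearMap.id ℂ (H →L[ℂ] H)) (ClsPH Z.ball) r) :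
    (∑ i, r i) / n ≤ Z.toLq q * (2 ^ (1 - 1 / p) * lam * (n : ℝ) ^ (-(1 / p))) := by
  classical
  obtain ⟨P, hP, hPc⟩ := exists_diag hH n
  let f : (Fin n → ℂ) → (H →L[ℂ] H) := fun z => ∑ i, z i • P i
  let a : (Fin n → ℕ) → (H →L[ℂ] H) := fun α => ∑ i, if α = Pi.single i 1 then P i else 0
  have hK := toLq_nonneg Z hq
  have hfb : ∀ z ∈ Z.ball, ‖f z‖ ≤ Z.toLq q := fun z hz =>
    hPc z _ hK (fun i => coord_le_toLq Z hq z hz i)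
  have hrep : Represents Z.ball f a (fun _ => 0) := by
    refine ⟨rfl, fun z hz => ?_⟩
    have hs : HasSum (fun α => mono z α • a α) (f z) := by
      have e : (fun α => mono z α • a α)
          = fun α => ∑ i, if α = Pi.single i 1 then z i • P i else 0 := by
        ext1 α
        simp only [a, Finset.smul_sum]
        refine Finset.sum_congr rfl fun i _ => ?_
        split_ifs with h
        · rw [h, mono_single]
        · simp
      rw [e]
      exact hasSum_sum fun i _ => hasSum_ite_eq _ _
    refine ⟨hs.summable, by simp, ?_⟩
    rw [hs.tsum_eq]; simp
  have h1 := hg f a (fun _ => 0) ⟨hrep, ⟨_, hfb⟩⟩ (Finset.univ.image fun i => Pi.single i 1)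
  rw [Finset.sum_image (fun i _ j _ h => single_one_inj i j h)] at h1
  have ha : ∀ i, a (Pi.single i 1) = P i := by
    intro i
    simp only [a]
    rw [Finset.sum_eq_single i]
    · simp
    · intro j _ hj
      exact if_neg fun h => hj (single_one_inj _ _ h).symm
    · simp
  have hp0 : p ≠ 0 := by linarith
  simp only [ContinuousLinearMap.id_apply, ha, hP, monoR_single, norm_zero, Real.one_rpow,
    Real.zero_rpow hp0, add_zero, one_mul] at h1
  have : Nonempty Z.ball := ⟨⟨0, zero_mem_ball Z⟩⟩
  have hsup : supNorm Z.ball f ≤ Z.toLq q := ciSup_le fun z => hfb z.1 z.2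
  have hsup0 : 0 ≤ supNorm Z.ball f := Real.iSup_nonneg fun _ => norm_nonneg _
  have hn : (0 : ℝ) < n := by exact_mod_cast Nat.pos_of_ne_zero (NeZero.ne n)
  have h2 := Real.rpow_arith_mean_le_arith_mean_rpow Finset.univ (fun _ : Fin n => (1 / n : ℝ)) r
    (fun _ _ => by positivity) (by simp [hn.ne']) (fun i _ => hr i) hp
  rw [← Finset.mul_sum, ← Finset.mul_sum] at h2
  have hlam0 : 0 < lam := by linarith
  have h3 : (1 / n * ∑ i, r i) ^ p ≤ (Z.toLq q * (lam * (n : ℝ) ^ (-(1 / p)))) ^ p := by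
    refine h2.trans ?_
    rw [Real.mul_rpow hK (by positivity), Real.mul_rpow (by positivity) (by positivity),
      ← Real.rpow_mul hn.le, neg_mul, one_div_mul_cancel hp0, Real.rpow_neg_one]
    calc _ ≤ 1 / (n : ℝ) * (lam ^ p * Z.toLq q ^ p) := by
          gcongr
          refine h1.trans ?_
          gcongr
      _ = _ := by rw [one_div]; ring
  have h4 : 1 / n * ∑ i, r i ≤ Z.toLq q * (lam * (n : ℝ) ^ (-(1 / p))) :=
    (Real.rpow_le_rpow_iff (mul_nonneg (by positivity) (Finset.sum_nonneg fun i _ => hr i))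
      (by positivity) (by linarith)).1 h3
  have h5 : (1 : ℝ) ≤ 2 ^ (1 - 1 / p) := by
    apply Real.one_le_rpow one_le_two
    rw [sub_nonneg, div_le_one (by linarith)]
    exact hp
  calc _ = 1 / n * ∑ i, r i := by ring
    _ ≤ Z.toLq q * (1 * lam * (n : ℝ) ^ (-(1 / p))) := by rw [one_mul]; exact h4
    _ ≤ _ := by gcongr

end

section

lemma mult_bound {n : ℕ} (α : Fin n → ℕ) (m : ℕ) (hm : ∑ i, α i = m) (hm0 : m ≠ 0) :
    (1 : ℝ) ≤ 3 ^ m * Nat.multinomial Finset.univ α * ∏ i, ((α i : ℝ) / m) ^ α i := by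
  have h1 := Nat.multinomial_spec Finset.univ α
  rw [hm] at h1
  have h1' : (∏ i, ((α i).factorial : ℝ)) * Nat.multinomial Finset.univ α = m.factorial := by
    exact_mod_cast h1
  have hmp : (0 : ℝ) < m := by exact_mod_cast Nat.pos_of_ne_zero hm0
  have h2 : ∏ i, ((α i : ℝ) / m) ^ α i = (∏ i, (α i : ℝ) ^ α i) / m ^ m := by
    simp only [div_pow, Finset.prod_div_distrib, Finset.prod_pow_eq_pow_sum, hm]
  have h3 : ∏ i, ((α i).factorial : ℝ) ≤ ∏ i, (α i : ℝ) ^ α i := by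
    refine Finset.prod_le_prod (fun i _ => by positivity) fun i _ => ?_
    exact_mod_cast Nat.factorial_le_pow (α i)
  have h4 : (m : ℝ) ^ m ≤ 3 ^ m * m.factorial := by
    have := Real.pow_div_factorial_le_exp (m : ℝ) hmp.le m
    rw [div_le_iff₀ (by positivity)] at this
    refine this.trans ?_
    gcongr
    rw [← mul_one (m : ℝ), Real.exp_nat_mul]
    gcongr
    exact Real.exp_one_lt_three.le
  rw [h2, ← mul_div_assoc, le_div_iff₀ (by positivity), one_mul]
  refine h4.trans ?_
  rw [← h1', mul_assoc, mul_comm (Nat.multinomial Finset.univ α : ℝ)]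
  gcongr

lemma multinomial_sum {n : ℕ} (hn : 0 < n) (m : ℕ) :
    ∑ α ∈ Finset.piAntidiag (Finset.univ : Finset (Fin n)) m,
      (Nat.multinomial Finset.univ α : ℝ) / n ^ m = 1 := by
  have h := Finset.sum_pow_eq_sum_piAntidiag (Finset.univ : Finset (Fin n))
    (fun _ => (1 : ℝ)) m
  simp only [Finset.sum_const, Finset.card_univ, Fintype.card_fin, nsmul_eq_mul, mul_one,
    one_pow, Finset.prod_const_one] at h
  rw [← Finset.sum_div, ← h]
  have : (n : ℝ) ^ m ≠ 0 := by positivity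
  exact div_self this

lemma multinomial_le_one {n : ℕ} (hn : 0 < n) (α : Fin n → ℕ) :
    (Nat.multinomial Finset.univ α : ℝ) / n ^ (∑ i, α i) ≤ 1 := by
  rw [← multinomial_sum hn (∑ i, α i)]
  exact Finset.single_le_sum (f := fun β : Fin n → ℕ =>
      (Nat.multinomial Finset.univ β : ℝ) / n ^ (∑ i, α i))
    (fun β _ => by positivity) (by simp)

/-- Summation step. -/
lemma sum_step {n : ℕ} (hn : 0 < n) (x L : ℝ) (hx : 0 ≤ x) (hx3 : x ≤ 1 / 3) (hL : 3 * x ≤ L - 1)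
    (F : Finset (Fin n → ℕ)) :
    ∑ α ∈ F, (if (∑ i, α i) = 0 then 1 else 2 * x ^ (∑ i, α i)) *
      ((Nat.multinomial Finset.univ α : ℝ) / n ^ (∑ i, α i)) ≤ L := by
  classical
  set G : ℕ → ℝ := fun m => if m = 0 then 1 else 2 * x ^ m with hG
  have hG0 : ∀ m, 0 ≤ G m := fun m => by simp only [hG]; split_ifs <;> positivity
  set D := F.sup (fun α => ∑ i, α i)
  have hD : ∀ α ∈ F, (∑ i, α i) ∈ Finset.range (D + 1) := fun α hα => by
    rw [Finset.mem_range, Nat.lt_succ_iff]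
    exact Finset.le_sup (f := fun α : Fin n → ℕ => ∑ i, α i) hα
  rw [← Finset.sum_fiberwise_of_maps_to hD]
  have h1 : ∀ m ∈ Finset.range (D + 1), ∑ α ∈ F with ∑ i, α i = m,
      G (∑ i, α i) * ((Nat.multinomial Finset.univ α : ℝ) / n ^ (∑ i, α i)) ≤ G m := by
    intro m _
    calc _ = ∑ α ∈ F with ∑ i, α i = m,
          G m * ((Nat.multinomial Finset.univ α : ℝ) / n ^ m) := by
          refine Finset.sum_congr rfl fun α hα => ?_
          rw [(Finset.mem_filter.1 hα).2]
      _ ≤ ∑ α ∈ Finset.piAntidiag (Finset.univ : Finset (Fin n)) m,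
          G m * ((Nat.multinomial Finset.univ α : ℝ) / n ^ m) := by
          refine Finset.sum_le_sum_of_subset_of_nonneg (fun α hα => ?_) fun α _ _ =>
            mul_nonneg (hG0 m) (by positivity)
          simpa using (Finset.mem_filter.1 hα).2
      _ = G m := by rw [← Finset.mul_sum, multinomial_sum hn, mul_one]
  refine (Finset.sum_le_sum h1).trans ?_
  rw [Finset.sum_range_succ']
  have h2 : ∑ k ∈ Finset.range D, G (k + 1) = 2 * x * ∑ k ∈ Finset.range D, x ^ k := by
    rw [Finset.mul_sum]
    refine Finset.sum_congr rfl fun k _ => ?_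
    simp only [hG, Nat.succ_ne_zero, if_false]
    ring
  have h3 : ∑ k ∈ Finset.range D, x ^ k ≤ 3 / 2 := by
    have hx1 : x < 1 := by linarith
    have := (summable_geometric_of_lt_one hx hx1).sum_le_tsum (Finset.range D)
      (fun i _ => by positivity)
    rw [tsum_geometric_of_lt_one hx hx1] at this
    refine this.trans ?_
    rw [inv_le_comm₀ (by linarith) (by norm_num)]
    linarith
  rw [h2]
  have h4 : G 0 = 1 := by simp [hG]
  rw [h4]
  nlinarith

end

section
variable {n : ℕ} {H : Type*} [NormedAddCommGroup H] [InnerProductSpace ℂ H] [CompleteSpace H]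

/-- Real-number core of the coefficient estimate. -/
lemma term_est (p Q A M K ρ v mu N : ℝ) (m : ℕ) (hQ : 1 ≤ Q) (hQp : Q ≤ p) (hA : 0 ≤ A)
    (hM : 0 ≤ M) (hK : 0 < K) (hρ : 0 ≤ ρ) (hv : 0 ≤ v) (hmu : 0 ≤ mu) (hN : 0 < N)
    (hw : mu / N ^ m ≤ 1) (hb : 1 ≤ 3 ^ m * mu * v)
    (hc : A * ((1 / (2 * K)) ^ m * v ^ (1 / Q)) ≤ M) :
    (A * (ρ * N ^ (-(1 / Q)) / K) ^ m) ^ p ≤ M ^ p * (((6 * ρ) ^ p) ^ m * (mu / N ^ m)) := by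
  have hQ0 : 0 < Q := by linarith
  have hQ1 : 1 / Q ≤ 1 := by rw [div_le_one hQ0]; exact hQ
  set w := mu / N ^ m with hwd
  have hw0 : 0 ≤ w := by positivity
  have h1 : (N ^ (-(1 / Q))) ^ m = ((N ^ m)⁻¹) ^ (1 / Q) := by
    rw [Real.inv_rpow (by positivity), Real.rpow_neg hN.le, inv_pow, ← Real.rpow_natCast,
      ← Real.rpow_natCast, ← Real.rpow_mul hN.le, ← Real.rpow_mul hN.le, mul_comm]
  have h2 : ((N ^ m)⁻¹) ^ (1 / Q) ≤ v ^ (1 / Q) * (3 ^ m * w ^ (1 / Q)) := by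
    calc ((N ^ m)⁻¹) ^ (1 / Q) ≤ (v * (3 ^ m * w)) ^ (1 / Q) := by
          apply Real.rpow_le_rpow (by positivity) _ (by positivity)
          have e : v * (3 ^ m * w) = (3 ^ m * mu * v) * (N ^ m)⁻¹ := by
            rw [hwd]; ring
          rw [e]
          exact le_mul_of_one_le_left (by positivity) hb
      _ = v ^ (1 / Q) * (((3 : ℝ) ^ m) ^ (1 / Q) * w ^ (1 / Q)) := by
          rw [Real.mul_rpow hv (by positivity), Real.mul_rpow (by positivity) hw0]
      _ ≤ _ := by
          gcongr
          calc ((3 : ℝ) ^ m) ^ (1 / Q) ≤ ((3 : ℝ) ^ m) ^ (1 : ℝ) := by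
                apply Real.rpow_le_rpow_of_exponent_le _ hQ1
                exact one_le_pow₀ (by norm_num)
            _ = 3 ^ m := Real.rpow_one _
  have h3 : A * (ρ * N ^ (-(1 / Q)) / K) ^ m ≤ M * ((6 * ρ) ^ m * w ^ (1 / Q)) := by
    calc A * (ρ * N ^ (-(1 / Q)) / K) ^ m
        = A * (1 / (2 * K)) ^ m * (2 * ρ) ^ m * ((N ^ m)⁻¹) ^ (1 / Q) := by
          rw [← h1]
          have : ρ * N ^ (-(1 / Q)) / K = (1 / (2 * K)) * (2 * ρ) * N ^ (-(1 / Q)) := by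
            field_simp
          rw [this, mul_pow, mul_pow]; ring
      _ ≤ A * (1 / (2 * K)) ^ m * (2 * ρ) ^ m * (v ^ (1 / Q) * (3 ^ m * w ^ (1 / Q))) := by
          gcongr
      _ = (A * ((1 / (2 * K)) ^ m * v ^ (1 / Q))) * ((6 * ρ) ^ m * w ^ (1 / Q)) := by
          have : (6 * ρ) ^ m = (2 * ρ) ^ m * 3 ^ m := by rw [← mul_pow]; ring
          rw [this]; ring
      _ ≤ _ := by gcongr
  have hp0 : 0 ≤ p := by linarith
  calc _ ≤ (M * ((6 * ρ) ^ m * w ^ (1 / Q))) ^ p :=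
        Real.rpow_le_rpow (by positivity) h3 hp0
    _ = M ^ p * (((6 * ρ) ^ p) ^ m * w ^ (p / Q)) := by
        rw [Real.mul_rpow hM (by positivity), Real.mul_rpow (by positivity) (by positivity),
          ← Real.rpow_mul hw0, ← Real.rpow_natCast, ← Real.rpow_natCast,
          ← Real.rpow_mul (by positivity), ← Real.rpow_mul (by positivity), mul_comm p (m : ℝ)]
        congr 3; ring
    _ ≤ _ := by
        gcongr
        calc w ^ (p / Q) ≤ w ^ (1 : ℝ) := by
              apply Real.rpow_le_rpow_of_exponent_ge' hw0 hw zero_le_one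
              rw [le_div_iff₀ hQ0]; linarith
          _ = w := Real.rpow_one w

lemma monoR_const (c : ℝ) (α : Fin n → ℕ) : monoR (fun _ => c) α = c ^ (∑ i, α i) := by
  simp [monoR, Finset.prod_pow_eq_pow_sum]

lemma lower_vec [NeZero n] (p lam : ℝ) (hp : 1 ≤ p) (hlam : 1 < lam) {q : ℝ≥0∞} (hq : 1 ≤ q)
    (hqt : q ≠ ∞) (hqp : q.toReal ≤ p) (Z : UncondNorm n) :
    GoodVec Z.ball p lam (ContinuousLinearMap.id ℂ (H →L[ℂ] H)) (ClsPH Z.ball)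
      (fun _ => (1 / 18 * ((lam ^ p - 1) ^ (1 / p) / lam)) * (n : ℝ) ^ (-(1 / q.toReal))
        / Z.fromLq q) := by
  intro f a b hf F
  have hn : 0 < n := Nat.pos_of_ne_zero (NeZero.ne n)
  have hnR : (0 : ℝ) < n := by exact_mod_cast hn
  have hQ := toReal_one_le hq hqt
  set Q := q.toReal with hQd
  have hQ0 : 0 < Q := by linarith
  have hK := fromLq_pos Z hq hqt
  set K := Z.fromLq q with hKd
  set ρ := 1 / 18 * ((lam ^ p - 1) ^ (1 / p) / lam) with hρd
  have hlp : 1 ≤ lam ^ p := Real.one_le_rpow hlam.le (by linarith)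
  have hlp1 : 0 ≤ lam ^ p - 1 := by linarith
  have hρ : 0 ≤ ρ := by positivity
  have hp0 : 0 < p := by linarith
  set M := supNorm Z.ball f with hMd
  have hfM : ∀ z ∈ Z.ball, ‖f z‖ ≤ M := fun z hz => supNorm_ge _ f hf.2 z hz
  have hM : 0 ≤ M := (norm_nonneg _).trans (hfM 0 (zero_mem_ball Z))
  -- constants
  set x := (6 * ρ) ^ p with hxd
  have hx0 : 0 ≤ x := by positivity
  have hxe : x = (1 / 3) ^ p * ((lam ^ p - 1) / lam ^ p) := by
    have : 6 * ρ = 1 / 3 * ((lam ^ p - 1) ^ (1 / p) / lam) := by rw [hρd]; ring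
    rw [hxd, this, Real.mul_rpow (by norm_num) (by positivity),
      Real.div_rpow (Real.rpow_nonneg hlp1 (1/p)) (by linarith : (0:ℝ) ≤ lam) p, ← Real.rpow_mul hlp1,
      one_div_mul_cancel hp0.ne', Real.rpow_one]
  have h13 : ((1 : ℝ) / 3) ^ p ≤ 1 / 3 := by
    calc ((1 : ℝ) / 3) ^ p ≤ (1 / 3) ^ (1 : ℝ) :=
          Real.rpow_le_rpow_of_exponent_ge (by norm_num) (by norm_num) hp
      _ = _ := Real.rpow_one _
  have hfr1 : (lam ^ p - 1) / lam ^ p ≤ 1 := by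
    rw [div_le_one (by linarith)]; linarith
  have hfr2 : (lam ^ p - 1) / lam ^ p ≤ lam ^ p - 1 := div_le_self hlp1 hlp
  have hfr0 : 0 ≤ (lam ^ p - 1) / lam ^ p := by positivity
  have hx1 : x ≤ 1 / 3 * ((lam ^ p - 1) / lam ^ p) := by
    rw [hxe]; gcongr
  -- termwise
  have hterm : ∀ α : Fin n → ℕ,
      (‖a α‖ ^ p + ‖b α‖ ^ p) * monoR (fun _ => ρ * (n : ℝ) ^ (-(1 / Q)) / K) α ^ p ≤
      M ^ p * ((if (∑ i, α i) = 0 then 1 else 2 * x ^ (∑ i, α i)) *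
      ((Nat.multinomial Finset.univ α : ℝ) / n ^ (∑ i, α i))) := by
    intro α
    rw [monoR_const]
    by_cases h0 : ∑ i, α i = 0
    · have hα : α = 0 := by
        ext i
        exact (Finset.sum_eq_zero_iff.1 h0) i (Finset.mem_univ i)
      have hc := (cauchy_est Z.ball f a b hf.1 M hfM 0 (fun i => le_rfl) (fun θ => by
        have : (fun i => (((0 : Fin n → ℝ) i : ℝ) : ℂ) * fourier 1 (θ i)) = 0 := by
          ext i; simp
        rw [this]; exact zero_mem_ball Z) α).1
      have hm1 : monoR (0 : Fin n → ℝ) α = 1 := by simp [monoR, hα]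
      rw [hm1, mul_one] at hc
      have hb : b α = 0 := by rw [hα]; exact hf.1.1
      have hmu : Nat.multinomial Finset.univ α = 1 := by simp [hα, Nat.multinomial]
      rw [h0, hmu, hb]
      simp only [norm_zero, Real.zero_rpow hp0.ne', pow_zero, Real.one_rpow, if_true, add_zero,
        mul_one, Nat.cast_one, div_one]
      exact Real.rpow_le_rpow (norm_nonneg _) hc hp0.le
    · set m := ∑ i, α i with hmd
      have hmR : (0 : ℝ) < m := by exact_mod_cast Nat.pos_of_ne_zero h0
      let u : Fin n → ℝ := fun i => ((α i : ℝ) / m) ^ (1 / Q)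
      have hu0 : ∀ i, 0 ≤ u i := fun i => by positivity
      have hu : Z.N (fun i => (u i : ℂ)) ≤ K := by
        refine N_le_fromLq Z hq _ ?_
        unfold lqNorm
        rw [if_neg hqt]
        have : ∑ i, ‖(u i : ℂ)‖ ^ q.toReal = 1 := by
          calc _ = ∑ i, (α i : ℝ) / m := by
                refine Finset.sum_congr rfl fun i _ => ?_
                rw [Complex.norm_real, Real.norm_of_nonneg (hu0 i), ← hQd]
                simp only [u]
                rw [← Real.rpow_mul (by positivity), one_div_mul_cancel hQ0.ne', Real.rpow_one]
            _ = 1 := by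
                rw [← Finset.sum_div, ← Nat.cast_sum, ← hmd, div_self hmR.ne']
        rw [this, Real.one_rpow]
      have hmem : ∀ θ : Fin n → UnitAddCircle,
          (fun i => (((1 / (2 * K)) * u i : ℝ) : ℂ) * fourier 1 (θ i)) ∈ Z.ball := by
        intro θ
        have e : (fun i => (((1 / (2 * K)) * u i : ℝ) : ℂ) * fourier 1 (θ i))
            = ((1 / (2 * K) : ℝ) : ℂ) • (fun i => fourier 1 (θ i) * (u i : ℂ)) := by
          ext i
          simp only [Pi.smul_apply, smul_eq_mul]
          push_cast; ring
        change Z.N _ < 1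
        rw [e, Z.smul_eq, Complex.norm_real, Real.norm_of_nonneg (by positivity)]
        have := Z.uncond (fun i => fourier 1 (θ i)) (fun i => (u i : ℂ))
          (fun i => (norm_fourier_one _).le)
        calc _ ≤ 1 / (2 * K) * K := by
              gcongr
              exact this.trans hu
          _ = 1 / 2 := by field_simp
          _ < 1 := by norm_num
      have hce := cauchy_est Z.ball f a b hf.1 M hfM (fun i => (1 / (2 * K)) * u i)
        (fun i => by have := hu0 i; positivity) hmem α
      set v := ∏ i, ((α i : ℝ) / m) ^ α i with hvd
      have hv0 : 0 ≤ v := Finset.prod_nonneg fun i _ => by positivity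
      have hmono : monoR (fun i => (1 / (2 * K)) * u i) α = (1 / (2 * K)) ^ m * v ^ (1 / Q) := by
        simp only [monoR, mul_pow, Finset.prod_mul_distrib, Finset.prod_pow_eq_pow_sum]
        rw [← hmd]
        congr 1
        rw [hvd, ← Real.finsetProd_rpow _ _ (fun i _ => by positivity)]
        refine Finset.prod_congr rfl fun i _ => ?_
        simp only [u]
        rw [← Real.rpow_natCast, ← Real.rpow_natCast, ← Real.rpow_mul (by positivity),
          ← Real.rpow_mul (by positivity), mul_comm]
      rw [hmono] at hce
      have hb := mult_bound α m rfl h0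
      have hw := multinomial_le_one hn α
      have t1 := term_est p Q ‖a α‖ M K ρ v (Nat.multinomial Finset.univ α) n m hQ hqp
        (norm_nonneg _) hM hK hρ hv0 (by positivity) hnR hw hb hce.1
      have t2 := term_est p Q ‖b α‖ M K ρ v (Nat.multinomial Finset.univ α) n m hQ hqp
        (norm_nonneg _) hM hK hρ hv0 (by positivity) hnR hw hb hce.2
      rw [Real.mul_rpow (norm_nonneg _) (by positivity)] at t1 t2
      rw [if_neg h0, add_mul]
      linarith
  calc _ ≤ ∑ α ∈ F, M ^ p * ((if (∑ i, α i) = 0 then 1 else 2 * x ^ (∑ i, α i)) *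
      ((Nat.multinomial Finset.univ α : ℝ) / n ^ (∑ i, α i))) :=
        Finset.sum_le_sum fun α _ => hterm α
    _ ≤ M ^ p * lam ^ p := by
        rw [← Finset.mul_sum]
        gcongr
        exact sum_step hn x (lam ^ p) hx0 (by linarith) (by linarith) F
    _ = _ := mul_comm _ _

end

/-- Theorem `thm-1.4-atm`: for infinite-dimensional `X = B(H)`,
`Ψ̃₁(n,λ,p,q)/‖Id : ℓ^n_q → Z‖ ≤ AP_λ(B_Z,p,X) ≤ ‖Id : Z → ℓ^n_q‖ · Ψ̃₂(n,λ,p,q)`,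
written out case by case. -/
theorem statement10 (p : ℝ) (hp : 1 ≤ p) (q : ℝ≥0∞) (hq : 1 ≤ q) :
    ∃ E₅ : ℝ, 0 < E₅ ∧ ∃ E₆ : ℝ, 0 < E₆ ∧
      ∀ (H : Type u) [NormedAddCommGroup H] [InnerProductSpace ℂ H] [CompleteSpace H],
        ¬ FiniteDimensional ℂ H →
        ∀ lam : ℝ, 1 < lam → ∀ n : ℕ, 0 < n → ∀ Z : UncondNorm n,
          (min (cotype (H →L[ℂ] H)) q < ENNReal.ofReal p →
            E₅ * ((lam ^ p - 1) ^ (1 / p) / lam) * (n : ℝ) ^ (-(q⁻¹.toReal)) / Z.fromLq q ≤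
              APradius Z.ball p lam (ContinuousLinearMap.id ℂ (H →L[ℂ] H))) ∧
          (ENNReal.ofReal p ≤ min (cotype (H →L[ℂ] H)) q →
            ∀ t : ℝ, 2 ≤ t → HasCotype (H →L[ℂ] H) t →
              E₆ * ((lam ^ p - 1) ^ (1 / p) / lam) *
                  (n : ℝ) ^ ((min (ENNReal.ofReal t) q)⁻¹.toReal - 1 / p - q⁻¹.toReal) /
                  Z.fromLq q ≤
                APradius Z.ball p lam (ContinuousLinearMap.id ℂ (H →L[ℂ] H))) ∧
          (q ≤ cotype (H →L[ℂ] H) →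
            APradius Z.ball p lam (ContinuousLinearMap.id ℂ (H →L[ℂ] H)) ≤
              Z.toLq q * (2 ^ (1 - 1 / p) * lam * (n : ℝ) ^ (-(1 / p)))) ∧
          (cotype (H →L[ℂ] H) < q →
            APradius Z.ball p lam (ContinuousLinearMap.id ℂ (H →L[ℂ] H)) ≤
              Z.toLq q * (2 ^ (1 - 1 / p) * lam *
                (n : ℝ) ^ ((cotype (H →L[ℂ] H))⁻¹.toReal - 1 / p - q⁻¹.toReal))) := by
  refine ⟨1 / 18, by norm_num, 1, one_pos, ?_⟩
  intro H _ _ _ hH lam hlam n hn Z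
  have : NeZero n := ⟨hn.ne'⟩
  have hub : ∀ t ∈ {t : ℝ | ∃ r : Fin n → ℝ, (∀ i, 0 ≤ r i) ∧
      GoodVec Z.ball p lam (ContinuousLinearMap.id ℂ (H →L[ℂ] H)) (ClsPH Z.ball) r ∧
      t = (∑ i, r i) / n}, t ≤ Z.toLq q * (2 ^ (1 - 1 / p) * lam * (n : ℝ) ^ (-(1 / p))) := by
    rintro t ⟨r, hr, hg, rfl⟩
    exact upper_vec hH p lam hp hlam hq Z r hr hg
  have hnR : (0 : ℝ) < n := by exact_mod_cast hn
  refine ⟨fun h => ?_, fun _ t ht hc => absurd hc (not_hasCotype hH t ht), fun _ => ?_,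
    fun h => ?_⟩
  · rw [cotype_top hH, min_eq_right le_top] at h
    have hqt : q ≠ ∞ := h.ne_top
    have hqp : q.toReal ≤ p := by
      have := ENNReal.toReal_mono ENNReal.ofReal_ne_top h.le
      rwa [ENNReal.toReal_ofReal (by linarith)] at this
    have hg := lower_vec (H := H) p lam hp hlam hq hqt hqp Z
    have hlp : 1 ≤ lam ^ p := Real.one_le_rpow hlam.le (by linarith)
    have hlp1 : 0 ≤ lam ^ p - 1 := by linarith
    have hK := fromLq_pos Z hq hqt
    refine le_csSup ⟨_, hub⟩ ⟨_, fun i => ?_, hg, ?_⟩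
    · positivity
    · rw [ENNReal.toReal_inv, ← one_div]
      simp only [Finset.sum_const, Finset.card_univ, Fintype.card_fin, nsmul_eq_mul]
      rw [mul_div_cancel_left₀ _ hnR.ne']
  · refine Real.sSup_le hub ?_
    have := toLq_nonneg Z hq
    positivity
  · rw [cotype_top hH] at h
    exact absurd h not_top_lt

end ArithBohr
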